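/- arXiv:2312.07719 — 5 statements merged into one kernel-verified Lean document; each statement's English description precedes it below -/
import Mathlib

section
/- Let α > 0 be a real number and (β_k)_{k∈ℕ} a sequence of real numbers such that β_k − β_{k−1} < α for every k ≥ 1 and lim_{k→∞} (β_k − β_{k−1}) = α. Then for every ε > 0 there exist natural numbers k, n, m such that 0 < |m·α − n·β_k| < ε. -/
theorem exists_nat_nat_abs_sub_mul_pos_le {x : ℝ} (hx : 0 ≤ x) {N : ℕ} (hN : 0 < N)
    (h : ∀ j : ℤ, (N.factorial : ℝ) * x ≠ j) :
    ∃ n m : ℕ, 0 < |(m : ℝ) - n * x| ∧ |(m : ℝ) - n * x| ≤ 1 / (N + 1) := by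
  obtain ⟨n, hn, hnN, hle⟩ := Real.exists_nat_abs_mul_sub_round_le x hN
  have hround : 0 ≤ round ((n : ℝ) * x) := by
    rw [round_eq]
    exact Int.floor_nonneg.2 (by positivity)
  obtain ⟨m, hm⟩ := Int.eq_ofNat_of_zero_le hround
  rw [hm, abs_sub_comm, Int.cast_natCast] at hle
  refine ⟨n, m, abs_pos.2 fun h0 => ?_, hle⟩
  obtain ⟨c, hc⟩ := Nat.dvd_factorial hn hnN
  refine h (c * m) ?_
  rw [hc]
  push_cast
  linear_combination -(c : ℝ) * h0

theorem tendsto_atTop_of_eventually_add_le_succ {β : ℕ → ℝ} {δ : ℝ} (hδ : 0 < δ) {K : ℕ}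
    (h : ∀ k, K ≤ k → β k + δ ≤ β (k + 1)) : Filter.Tendsto β Filter.atTop Filter.atTop := by
  rw [← Filter.tendsto_add_atTop_iff_nat K]
  have hlin : ∀ j : ℕ, β K + j * δ ≤ β (j + K) := by
    intro j
    induction j with
    | zero => simp
    | succ j ih =>
      have hj := h (j + K) (Nat.le_add_left K j)
      rw [Nat.add_right_comm]
      push_cast
      linarith
  exact Filter.tendsto_atTop_mono hlin (Filter.tendsto_atTop_add_const_left _ _
    (tendsto_natCast_atTop_atTop.atTop_mul_const hδ))

theorem arithmetic_lemma
    (α : ℝ) (hα : 0 < α) (β : ℕ → ℝ)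
    (hlt : ∀ k : ℕ, 1 ≤ k → β k - β (k - 1) < α)
    (hlim : Filter.Tendsto (fun k : ℕ => β k - β (k - 1)) Filter.atTop (nhds α)) :
    ∀ ε : ℝ, 0 < ε → ∃ k n m : ℕ,
      0 < |(m : ℝ) * α - (n : ℝ) * β k| ∧ |(m : ℝ) * α - (n : ℝ) * β k| < ε := by
  intro ε hε
  have hstep : Filter.Tendsto (fun k : ℕ => β (k + 1) - β k) Filter.atTop (nhds α) := by
    simpa [Function.comp_def] using hlim.comp (Filter.tendsto_add_atTop_nat 1)
  have hβ : Filter.Tendsto β Filter.atTop Filter.atTop := by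
    obtain ⟨K, hK⟩ := Filter.eventually_atTop.1 (hstep.eventually_const_lt (half_lt_self hα))
    exact tendsto_atTop_of_eventually_add_le_succ (half_pos hα) (K := K)
      fun k hk => by linarith [hK k hk]
  obtain ⟨N, hN⟩ := exists_nat_gt (α / ε)
  have hNpos : 0 < N := by exact_mod_cast (div_pos hα hε).trans hN
  obtain ⟨k, hk, hnot⟩ : ∃ k, 0 ≤ β k ∧ ∀ j : ℤ, (N.factorial : ℝ) * (β k / α) ≠ j := by
    by_contra! hint
    have hfac : (0 : ℝ) < N.factorial := by exact_mod_cast N.factorial_pos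
    have hgap : α - α / N.factorial < α := sub_lt_self _ (by positivity)
    obtain ⟨k, hk0, hk1, hk⟩ := ((hβ.eventually_ge_atTop 0).and
      (((Filter.tendsto_add_atTop_nat 1).eventually (hβ.eventually_ge_atTop 0)).and
        (hstep.eventually_const_lt hgap))).exists
    obtain ⟨i, hi⟩ := hint k hk0
    obtain ⟨j, hj⟩ := hint (k + 1) hk1
    have hlt' : β (k + 1) - β k < α := by simpa using hlt (k + 1) (Nat.le_add_left 1 k)
    have hdiff : ((j - i : ℤ) : ℝ) = N.factorial * ((β (k + 1) - β k) / α) := by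
      push_cast
      rw [← hi, ← hj]
      ring
    have hupper : j - i < N.factorial := by
      have : ((j - i : ℤ) : ℝ) < N.factorial := by
        rw [hdiff]
        exact mul_lt_of_lt_one_right hfac ((div_lt_one hα).2 hlt')
      exact_mod_cast this
    have hlower : (N.factorial : ℤ) - 1 < j - i := by
      have : (N.factorial : ℝ) - 1 < ((j - i : ℤ) : ℝ) := by
        rw [hdiff]
        calc (N.factorial : ℝ) - 1 = N.factorial * ((α - α / N.factorial) / α) := by
              field_simp
          _ < _ := by gcongr
      exact_mod_cast this
    omega
  obtain ⟨n, m, hpos, hle⟩ := exists_nat_nat_abs_sub_mul_pos_le (div_nonneg hk hα.le) hNpos hnot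
  have hscale : |(m : ℝ) * α - n * β k| = |(m : ℝ) - n * (β k / α)| * α := by
    rw [← abs_of_pos hα, ← abs_mul, abs_of_pos hα]
    congr 1
    field_simp
  refine ⟨k, n, m, hscale ▸ mul_pos hpos hα, ?_⟩
  rw [hscale]
  calc |(m : ℝ) - n * (β k / α)| * α ≤ 1 / (N + 1) * α := by gcongr
    _ < ε := by
      rw [div_lt_iff₀ hε] at hN
      rw [one_div_mul_eq_div, div_lt_iff₀ (by positivity)]
      linarith
end

section
/- Let α > 0 be a real number and (β_k)_{k∈ℕ} a sequence of real numbers such that β_k − β_{k−1} < α for every k ≥ 1 and lim_{k→∞} (β_k − β_{k−1}) = α. Suppose that for every k the quotient β_k/α is a rational number. Then the denominators of these quotients are unbounded: for every N ∈ ℕ there exist k ∈ ℕ and a rational number q with (q : ℝ) = β_k/α whose denominator (in lowest terms) is greater than N. -/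
theorem Rat.exists_int_eq_factorial_mul {q : ℚ} {N : ℕ} (h : q.den ≤ N) :
    ∃ m : ℤ, (m : ℚ) = (N.factorial : ℚ) * q := by
  obtain ⟨c, hc⟩ := Nat.dvd_factorial q.den_pos h
  refine ⟨c * q.num, ?_⟩
  rw [hc]
  push_cast
  linear_combination -(c : ℚ) * q.mul_den_eq_num

theorem denominators_unbounded
    (α : ℝ) (hα : 0 < α) (β : ℕ → ℝ)
    (hlt : ∀ k : ℕ, 1 ≤ k → β k - β (k - 1) < α)
    (hlim : Filter.Tendsto (fun k : ℕ => β k - β (k - 1)) Filter.atTop (nhds α))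
    (hrat : ∀ k : ℕ, ∃ q : ℚ, (q : ℝ) = β k / α) :
    ∀ N : ℕ, ∃ (k : ℕ) (q : ℚ), (q : ℝ) = β k / α ∧ N < q.den := by
  intro N
  by_contra! hden
  have hD : (0 : ℝ) < N.factorial := by exact_mod_cast N.factorial_pos
  have hint : ∀ k, ∃ m : ℤ, (m : ℝ) * α = N.factorial * β k := by
    intro k
    obtain ⟨q, hq⟩ := hrat k
    obtain ⟨m, hm⟩ := Rat.exists_int_eq_factorial_mul (hden k q hq)
    have hm' : (m : ℝ) = N.factorial * q := by exact_mod_cast hm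
    refine ⟨m, ?_⟩
    rw [hm', hq]
    field_simp
  choose m hm using hint
  have hgap : ∀ k, 1 ≤ k → β k - β (k - 1) ≤ α - α / N.factorial := by
    intro k hk
    have hlt' : ((m k - m (k - 1) : ℤ) : ℝ) < (N.factorial : ℤ) := by
      push_cast
      refine lt_of_mul_lt_mul_right ?_ hα.le
      linarith [hm k, hm (k - 1), mul_lt_mul_of_pos_left (hlt k hk) hD]
    have hle : ((m k - m (k - 1) : ℤ) : ℝ) ≤ N.factorial - 1 := by
      exact_mod_cast Int.le_sub_one_of_lt (Int.cast_lt.mp hlt')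
    push_cast at hle
    refine le_of_mul_le_mul_left ?_ hD
    rw [mul_sub, mul_sub, mul_div_cancel₀ _ hD.ne']
    linarith [hm k, hm (k - 1), mul_le_mul_of_nonneg_right hle hα.le]
  have hle := le_of_tendsto hlim (Filter.eventually_atTop.mpr ⟨1, hgap⟩)
  linarith [div_pos hα hD]
end

section
/- Let α > 0 and a > 0 be real numbers and let (β_k)_{k∈ℕ} be a sequence of real numbers such that β_k − β_{k−1} < α for every k ≥ 1 and lim_{k→∞} (β_k − β_{k−1}) = α. Then for every ε > 0 there exist natural numbers k, n, m such that either 0 < |m·a − n·β_k| < ε or 0 < |m·a − n·α| < ε. -/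
/-- Dirichlet approximation of a nonnegative real by multiples of `a`, with nonnegative
coefficients and a bound on the denominator that does not depend on the approximated number. -/
theorem exists_nat_bound_abs_mul_sub_mul_lt {a ε : ℝ} (ha : 0 < a) (hε : 0 < ε) :
    ∃ N : ℕ, ∀ x : ℝ, 0 ≤ x →
      ∃ n m : ℕ, 0 < n ∧ n ≤ N ∧ |(m : ℝ) * a - (n : ℝ) * x| < ε := by
  obtain ⟨N, hN⟩ := exists_nat_one_div_lt (div_pos hε ha)
  refine ⟨N + 1, fun x hx => ?_⟩
  obtain ⟨n, hn0, hnN, hn⟩ := Real.exists_nat_abs_mul_sub_round_le (x / a) N.succ_pos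
  have hround : 0 ≤ round ((n : ℝ) * (x / a)) := by
    rw [round_eq]
    exact Int.floor_nonneg.2 (by positivity)
  obtain ⟨m, hm⟩ := Int.eq_ofNat_of_zero_le hround
  refine ⟨n, m, hn0, hnN, ?_⟩
  rw [hm] at hn
  have hle : (1 : ℝ) / ((N.succ : ℕ) + 1) ≤ 1 / ((N : ℝ) + 1) := by
    push_cast
    gcongr
    linarith
  have hlt : |(n : ℝ) * (x / a) - m| < ε / a := by
    simpa using (hn.trans hle).trans_lt hN
  have hmul : (m : ℝ) * a - n * x = -((n * (x / a) - m) * a) := by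
    field_simp
    ring
  rw [hmul, abs_neg, abs_mul, abs_of_pos ha]
  exact (lt_div_iff₀ ha).1 hlt

/-- A real sequence whose consecutive differences have a positive limit tends to infinity. -/
theorem tendsto_atTop_of_tendsto_sub_pos {u : ℕ → ℝ} {l : ℝ} (hl : 0 < l)
    (hu : Filter.Tendsto (fun k => u (k + 1) - u k) Filter.atTop (nhds l)) :
    Filter.Tendsto u Filter.atTop Filter.atTop := by
  obtain ⟨K, hK⟩ := Filter.eventually_atTop.1 (hu.eventually (lt_mem_nhds (half_lt_self hl)))
  rw [← Filter.tendsto_add_atTop_iff_nat K]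
  have hlow : ∀ i : ℕ, u K + i * (l / 2) ≤ u (i + K) := by
    intro i
    induction i with
    | zero => simp
    | succ i ih =>
      have h := hK (i + K) (Nat.le_add_left K i)
      rw [show i + 1 + K = i + K + 1 by ring]
      push_cast
      linarith
  exact Filter.tendsto_atTop_mono hlow (Filter.tendsto_atTop_add_const_left _ _
    (tendsto_natCast_atTop_atTop.atTop_mul_const (half_pos hl)))

theorem arithmetic_lemma_combined
    (α a : ℝ) (hα : 0 < α) (ha : 0 < a) (β : ℕ → ℝ)
    (hlt : ∀ k : ℕ, 1 ≤ k → β k - β (k - 1) < α)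
    (hlim : Filter.Tendsto (fun k : ℕ => β k - β (k - 1)) Filter.atTop (nhds α)) :
    ∀ ε : ℝ, 0 < ε → ∃ k n m : ℕ,
      (0 < |(m : ℝ) * a - (n : ℝ) * β k| ∧ |(m : ℝ) * a - (n : ℝ) * β k| < ε) ∨
      (0 < |(m : ℝ) * a - (n : ℝ) * α| ∧ |(m : ℝ) * a - (n : ℝ) * α| < ε) := by
  intro ε hε
  obtain ⟨N, hN⟩ := exists_nat_bound_abs_mul_sub_mul_lt ha hε
  obtain ⟨p, q, hp, -, hpq⟩ := hN α hα.le
  by_cases hpq0 : (q : ℝ) * a - p * α = 0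
  swap
  · exact ⟨0, p, q, Or.inr ⟨abs_pos.2 hpq0, hpq⟩⟩
  have hstep : Filter.Tendsto (fun k => β (k + 1) - β k) Filter.atTop (nhds α) := by
    simpa [Function.comp_def] using hlim.comp (Filter.tendsto_add_atTop_nat 1)
  have hsmall : Filter.Tendsto (fun k => (N : ℝ) * p * (α - (β (k + 1) - β k)))
      Filter.atTop (nhds 0) := by
    simpa using (hstep.const_sub α).const_mul ((N : ℝ) * p)
  obtain ⟨k, hk, hk0⟩ := ((hsmall.eventually (gt_mem_nhds hε)).and
    ((tendsto_atTop_of_tendsto_sub_pos hα hstep).eventually_ge_atTop 0)).exists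
  obtain ⟨n, m, hn, hnN, hnm⟩ := hN (β k) hk0
  by_cases hnm0 : (m : ℝ) * a - n * β k = 0
  swap
  · exact ⟨k, n, m, Or.inl ⟨abs_pos.2 hnm0, hnm⟩⟩
  have hgap : 0 < α - (β (k + 1) - β k) := by
    simpa using hlt (k + 1) (Nat.le_add_left 1 k)
  have heq : ((m * p + n * q : ℕ) : ℝ) * a - ((n * p : ℕ) : ℝ) * β (k + 1)
      = n * p * (α - (β (k + 1) - β k)) := by
    push_cast
    linear_combination (p : ℝ) * hnm0 + (n : ℝ) * hpq0
  have hpos : 0 < (n : ℝ) * p * (α - (β (k + 1) - β k)) := by positivity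
  refine ⟨k + 1, n * p, m * p + n * q, Or.inl ?_⟩
  rw [heq, abs_of_pos hpos]
  refine ⟨hpos, lt_of_le_of_lt ?_ hk⟩
  gcongr
end

section
/- Let X be a metric space, x₀ ∈ X, let α : ℝ → X be a map such that dist(α(s), x₀) → +∞ as s → +∞, and let β : ℝ → X be a continuous map. If inf-dist(β(s), α([0,∞))) → +∞ as s → +∞, then inf-dist(α(s), β([0,∞))) → +∞ as s → +∞. -/
theorem divergence_asymmetric
    {X : Type*} [MetricSpace X] (x₀ : X) (α β : ℝ → X)
    (hα : Filter.Tendsto (fun s => dist (α s) x₀) Filter.atTop Filter.atTop)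
    (hβ : Continuous β)
    (hdiv : Filter.Tendsto (fun s => Metric.infDist (β s) (α '' Set.Ici (0 : ℝ)))
      Filter.atTop Filter.atTop) :
    Filter.Tendsto (fun s => Metric.infDist (α s) (β '' Set.Ici (0 : ℝ)))
      Filter.atTop Filter.atTop := by
  rw [Filter.tendsto_atTop]
  intro M
  obtain ⟨T, hT⟩ := Filter.eventually_atTop.mp (hdiv.eventually_ge_atTop M)
  obtain ⟨R, hR⟩ :=
    ((isCompact_Icc (a := (0 : ℝ)) (b := T)).image hβ).isBounded.subset_closedBall x₀
  filter_upwards [hα.eventually_ge_atTop (R + M), Filter.eventually_ge_atTop (0 : ℝ)] with s hs hs0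
  refine (Metric.le_infDist (Set.nonempty_Ici.image β)).mpr ?_
  rintro _ ⟨t, ht, rfl⟩
  rcases le_total T t with hTt | htT
  · calc M ≤ Metric.infDist (β t) (α '' Set.Ici 0) := hT t hTt
      _ ≤ dist (β t) (α s) := Metric.infDist_le_dist_of_mem (Set.mem_image_of_mem α hs0)
      _ = dist (α s) (β t) := dist_comm _ _
  · have hβt : dist (β t) x₀ ≤ R := hR (Set.mem_image_of_mem β ⟨ht, htT⟩)
    linarith [dist_triangle (α s) (β t) x₀]
end

section
/- Let X be a metric space, x₀ ∈ X, and let α, β : ℝ → X be continuous maps such that dist(α(s), x₀) → +∞ and dist(β(s), x₀) → +∞ as s → +∞. Then inf-dist(α(s), β([0,∞))) → +∞ as s → +∞ if and only if inf-dist(β(s), α([0,∞))) → +∞ as s → +∞. -/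
/-- If `β` leaves every bounded set and `α` diverges from the ray `β([0,∞))`, then `β` diverges
from the ray `α([0,∞))`. -/
theorem tendsto_infDist_image_Ici_swap {X : Type*} [PseudoMetricSpace X] (x₀ : X) {α β : ℝ → X}
    (hαc : Continuous α)
    (hβ : Filter.Tendsto (fun s => dist (β s) x₀) Filter.atTop Filter.atTop)
    (h : Filter.Tendsto (fun s => Metric.infDist (α s) (β '' Set.Ici (0 : ℝ)))
      Filter.atTop Filter.atTop) :
    Filter.Tendsto (fun s => Metric.infDist (β s) (α '' Set.Ici (0 : ℝ)))
      Filter.atTop Filter.atTop := by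
  rw [Filter.tendsto_atTop]
  intro M
  obtain ⟨S, hS⟩ := Filter.eventually_atTop.1 (Filter.tendsto_atTop.1 h M)
  obtain ⟨R, hR⟩ :=
    ((isCompact_Icc (a := (0 : ℝ)) (b := S)).image hαc).isBounded.subset_closedBall x₀
  filter_upwards [Filter.tendsto_atTop.1 hβ (R + M), Filter.eventually_ge_atTop 0] with s hs hs0
  refine (Metric.le_infDist (Set.nonempty_Ici.image α)).2 ?_
  rintro _ ⟨t, ht, rfl⟩
  rcases le_total S t with hSt | htS
  · rw [dist_comm]
    exact (hS t hSt).trans (Metric.infDist_le_dist_of_mem (Set.mem_image_of_mem β hs0))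
  · have hαt : dist (α t) x₀ ≤ R := hR (Set.mem_image_of_mem α ⟨ht, htS⟩)
    linarith [dist_triangle (β s) (α t) x₀]

theorem divergence_equivalence
    {X : Type*} [MetricSpace X] (x₀ : X) (α β : ℝ → X)
    (hαc : Continuous α) (hβc : Continuous β)
    (hα : Filter.Tendsto (fun s => dist (α s) x₀) Filter.atTop Filter.atTop)
    (hβ : Filter.Tendsto (fun s => dist (β s) x₀) Filter.atTop Filter.atTop) :
    Filter.Tendsto (fun s => Metric.infDist (α s) (β '' Set.Ici (0 : ℝ)))
      Filter.atTop Filter.atTop ↔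
    Filter.Tendsto (fun s => Metric.infDist (β s) (α '' Set.Ici (0 : ℝ)))
      Filter.atTop Filter.atTop :=
  ⟨tendsto_infDist_image_Ici_swap x₀ hαc hβ, tendsto_infDist_image_Ici_swap x₀ hβc hα⟩
end
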